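/- The 4-dimensional superalgebra A = K[x,y,z]/(x,y,z)² (the commutative algebra with basis 1, x, y, z in which every product of two of the generators x, y, z is zero) with grading A₀ = span{1, x, y} and A₁ = span{z} admits no superbialgebra structure: there exist no grading-preserving K-linear maps Δ : A → A ⊗ A and ε : A → K making this superalgebra into a superbialgebra. -/

import Mathlib

open TensorProduct

section SuperDefs

variable (K A : Type*) [Field K] [Ring A] [Algebra K A]

/-- A superalgebra structure on the unital associative `K`-algebra `A`: a `ℤ/2ℤ`-grading
`A = A₀ ⊕ A₁` of `K`-vector spaces with `1 ∈ A₀` and `Aᵢ · Aⱼ ⊆ A_{i+j mod 2}`. -/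
structure SuperAlgebra where
  A₀ : Submodule K A
  A₁ : Submodule K A
  compl : IsCompl A₀ A₁
  one_mem : (1 : A) ∈ A₀
  mul_mem₀₀ : ∀ a ∈ A₀, ∀ b ∈ A₀, a * b ∈ A₀
  mul_mem₀₁ : ∀ a ∈ A₀, ∀ b ∈ A₁, a * b ∈ A₁
  mul_mem₁₀ : ∀ a ∈ A₁, ∀ b ∈ A₀, a * b ∈ A₁
  mul_mem₁₁ : ∀ a ∈ A₁, ∀ b ∈ A₁, a * b ∈ A₀

namespace SuperAlgebra

variable {K A}

/-- The projection onto the even part along the odd part. -/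
noncomputable def p₀ (S : SuperAlgebra K A) : A →ₗ[K] A :=
  S.A₀.subtype ∘ₗ Submodule.linearProjOfIsCompl S.A₀ S.A₁ S.compl

/-- The projection onto the odd part along the even part. -/
noncomputable def p₁ (S : SuperAlgebra K A) : A →ₗ[K] A :=
  S.A₁.subtype ∘ₗ Submodule.linearProjOfIsCompl S.A₁ S.A₀ S.compl.symm

/-- The superflip `τ : A ⊗ A → A ⊗ A`, `a ⊗ b ↦ (-1)^{|a||b|} b ⊗ a` on homogeneous
elements. -/
noncomputable def τ (S : SuperAlgebra K A) : A ⊗[K] A →ₗ[K] A ⊗[K] A :=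
  (TensorProduct.comm K A A).toLinearMap ∘ₗ
    (TensorProduct.map S.p₀ S.p₀ + TensorProduct.map S.p₀ S.p₁ +
      TensorProduct.map S.p₁ S.p₀ - TensorProduct.map S.p₁ S.p₁)

variable (K A) in
/-- Regrouping `(A ⊗ A) ⊗ (A ⊗ A) ≃ A ⊗ ((A ⊗ A) ⊗ A)`. -/
noncomputable def rearr : ((A ⊗[K] A) ⊗[K] (A ⊗[K] A)) ≃ₗ[K] (A ⊗[K] ((A ⊗[K] A) ⊗[K] A)) :=
  (TensorProduct.assoc K A A (A ⊗[K] A)) ≪≫ₗ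
    TensorProduct.congr (LinearEquiv.refl K A) (TensorProduct.assoc K A A A).symm

/-- The map `(μ ⊗ μ) ∘ (id ⊗ τ ⊗ id) : (A ⊗ A) ⊗ (A ⊗ A) → A ⊗ A`, i.e. the super
multiplication of `A ⊗ A`. -/
noncomputable def superBimul (S : SuperAlgebra K A) :
    ((A ⊗[K] A) ⊗[K] (A ⊗[K] A)) →ₗ[K] A ⊗[K] A :=
  TensorProduct.map (LinearMap.mul' K A) (LinearMap.mul' K A) ∘ₗ
    (rearr K A).symm.toLinearMap ∘ₗ
    TensorProduct.map (LinearMap.id : A →ₗ[K] A)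
      (TensorProduct.map S.τ (LinearMap.id : A →ₗ[K] A)) ∘ₗ
    (rearr K A).toLinearMap

/-- The even part of `A ⊗ A` for the total grading. -/
def evenTensor (S : SuperAlgebra K A) : Submodule K (A ⊗[K] A) :=
  LinearMap.range (TensorProduct.map S.A₀.subtype S.A₀.subtype) ⊔
    LinearMap.range (TensorProduct.map S.A₁.subtype S.A₁.subtype)

/-- The odd part of `A ⊗ A` for the total grading. -/
def oddTensor (S : SuperAlgebra K A) : Submodule K (A ⊗[K] A) :=
  LinearMap.range (TensorProduct.map S.A₀.subtype S.A₁.subtype) ⊔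
    LinearMap.range (TensorProduct.map S.A₁.subtype S.A₀.subtype)

end SuperAlgebra

/-- A superbialgebra over `K`: a superalgebra together with grading-preserving linear maps
`Δ : A → A ⊗ A` and `ε : A → K` satisfying coassociativity, counity, and compatibility
with the (super)algebra structure. -/
structure SuperBialgebra extends SuperAlgebra K A where
  Δ : A →ₗ[K] A ⊗[K] A
  ε : A →ₗ[K] K
  Δ_even : ∀ a ∈ A₀, Δ a ∈ toSuperAlgebra.evenTensor
  Δ_odd : ∀ a ∈ A₁, Δ a ∈ toSuperAlgebra.oddTensor
  ε_odd : ∀ a ∈ A₁, ε a = 0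
  coassoc : ∀ a : A,
    TensorProduct.assoc K A A A (TensorProduct.map Δ (LinearMap.id : A →ₗ[K] A) (Δ a)) =
      TensorProduct.map (LinearMap.id : A →ₗ[K] A) Δ (Δ a)
  counit_left : ∀ a : A,
    TensorProduct.lid K A (TensorProduct.map ε (LinearMap.id : A →ₗ[K] A) (Δ a)) = a
  counit_right : ∀ a : A,
    TensorProduct.rid K A (TensorProduct.map (LinearMap.id : A →ₗ[K] A) ε (Δ a)) = a
  Δ_one : Δ 1 = 1 ⊗ₜ[K] 1
  ε_one : ε 1 = 1
  ε_mul : ∀ a b : A, ε (a * b) = ε a * ε b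
  Δ_mul : ∀ a b : A, Δ (a * b) = toSuperAlgebra.superBimul (Δ a ⊗ₜ[K] Δ b)

/-- A Hopf superalgebra: a superbialgebra with a grading-preserving antipode `S`
satisfying `μ ∘ (S ⊗ id) ∘ Δ = μ ∘ (id ⊗ S) ∘ Δ = η ∘ ε`. -/
structure HopfSuperalgebra extends SuperBialgebra K A where
  antipode : A →ₗ[K] A
  antipode_even : ∀ a ∈ A₀, antipode a ∈ A₀
  antipode_odd : ∀ a ∈ A₁, antipode a ∈ A₁
  antipode_left : ∀ a : A,
    LinearMap.mul' K A (TensorProduct.map antipode (LinearMap.id : A →ₗ[K] A) (Δ a)) =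
      algebraMap K A (ε a)
  antipode_right : ∀ a : A,
    LinearMap.mul' K A (TensorProduct.map (LinearMap.id : A →ₗ[K] A) antipode (Δ a)) =
      algebraMap K A (ε a)

end SuperDefs


/-- the superalgebra `K[x,y,z]/(x,y,z)²` with even part `span{1, x, y}`
and odd part `span{z}` admits no superbialgebra structure. -/
theorem Kxyz_mod_square_admits_no_superbialgebra
    {K A : Type*} [Field K] [IsAlgClosed K] [CharZero K] [Ring A] [Algebra K A]
    (B : SuperBialgebra K A) (x y z : A)
    (hxx : x * x = 0) (hxy : x * y = 0) (hxz : x * z = 0)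
    (hyx : y * x = 0) (hyy : y * y = 0) (hyz : y * z = 0)
    (hzx : z * x = 0) (hzy : z * y = 0) (hzz : z * z = 0)
    (hind : LinearIndependent K ![(1 : A), x, y, z])
    (h0 : B.A₀ = Submodule.span K {1, x, y})
    (h1 : B.A₁ = Submodule.span K {z}) :
    False := by
  have hx0 : B.ε x = 0 := by
    have h := B.ε_mul x x
    rw [hxx, map_zero] at h
    exact mul_self_eq_zero.mp h.symm
  have hy0 : B.ε y = 0 := by
    have h := B.ε_mul y y
    rw [hyy, map_zero] at h
    exact mul_self_eq_zero.mp h.symm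
  have hz0 : B.ε z = 0 := by
    have h := B.ε_mul z z
    rw [hzz, map_zero] at h
    exact mul_self_eq_zero.mp h.symm
  have htop : ⊤ ≤ Submodule.span K (Set.range ![(1 : A), x, y, z]) := by
    rw [← B.compl.sup_eq_top, h0, h1, ← Submodule.span_union]
    apply Submodule.span_mono
    rintro w ((rfl | rfl | rfl) | rfl)
    · exact ⟨0, rfl⟩
    · exact ⟨1, rfl⟩
    · exact ⟨2, rfl⟩
    · exact ⟨3, rfl⟩
  let b := Module.Basis.mk hind htop
  have hb : ∀ i, b i = ![(1 : A), x, y, z] i := fun i => by simp [b]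
  obtain ⟨φ, f1, fx, fy, fz⟩ : ∃ φ : A →ₗ[K] K, φ 1 = 0 ∧ φ x = 1 ∧ φ y = 0 ∧ φ z = 0 := by
    refine ⟨b.coord 1, ?_, ?_, ?_, ?_⟩
    · have : (1 : A) = b 0 := by simp [hb]
      rw [this]; simp
    · have : x = b 1 := by simp [hb]
      rw [this]; simp
    · have : y = b 2 := by simp [hb]
      rw [this]; simp
    · have : z = b 3 := by simp [hb]
      rw [this]; simp
  -- `φ` is an `ε`-derivation
  have hder : ∀ u v : A, φ (u * v) = φ u * B.ε v + B.ε u * φ v := by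
    have key : (LinearMap.mul K A).compr₂ φ =
        (LinearMap.mul K K).compl₁₂ φ B.ε + (LinearMap.mul K K).compl₁₂ B.ε φ := by
      refine b.ext fun i => b.ext fun j => ?_
      fin_cases i <;> fin_cases j <;>
        simp [hb, hxx, hxy, hxz, hyx, hyy, hyz, hzx, hzy, hzz, f1, fx, fy, fz,
          hx0, hy0, hz0, B.ε_one]
    intro u v
    simpa using LinearMap.congr_fun₂ key u v
  have hp1 : ∀ u : A, ∃ c : K, B.p₁ u = c • z := by
    intro u
    have h : B.p₁ u ∈ B.A₁ := by simp [SuperAlgebra.p₁]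
    rw [h1, Submodule.mem_span_singleton] at h
    obtain ⟨c, hc⟩ := h
    exact ⟨c, hc.symm⟩
  have fp1 : ∀ u, φ (B.p₁ u) = 0 := fun u => by
    obtain ⟨c, hc⟩ := hp1 u
    simp [hc, fz]
  have ep1 : ∀ u, B.ε (B.p₁ u) = 0 := fun u => by
    obtain ⟨c, hc⟩ := hp1 u
    simp [hc, hz0]
  have hp01 : ∀ u, B.p₀ u = u - B.p₁ u := fun u => by
    have h := Submodule.projection_add_projection_eq_self B.compl u
    rw [eq_sub_iff_add_eq]
    exact h
  have fp0 : ∀ u, φ (B.p₀ u) = φ u := fun u => by simp [hp01, fp1]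
  have ep0 : ∀ u, B.ε (B.p₀ u) = B.ε u := fun u => by simp [hp01, ep1]
  let T : (A →ₗ[K] K) → (A →ₗ[K] K) → (A ⊗[K] A →ₗ[K] K) := fun f g =>
    LinearMap.mul' K K ∘ₗ TensorProduct.map f g
  have hT : ∀ f g u v, T f g (u ⊗ₜ v) = f u * g v := fun f g u v => by simp [T]
  have main : ∀ U V : A ⊗[K] A, T φ φ (B.superBimul (U ⊗ₜ[K] V)) =
      T φ φ U * T B.ε B.ε V + T φ B.ε U * T B.ε φ V
        + T B.ε φ U * T φ B.ε V + T B.ε B.ε U * T φ φ V := by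
    intro U V
    induction U using TensorProduct.induction_on with
    | zero => simp
    | add U₁ U₂ h₁ h₂ => rw [TensorProduct.add_tmul, map_add, map_add, h₁, h₂]; simp only [map_add]; ring
    | tmul a c =>
      induction V using TensorProduct.induction_on with
      | zero => simp
      | add U₁ U₂ h₁ h₂ => rw [TensorProduct.tmul_add, map_add, map_add, h₁, h₂]; simp only [map_add]; ring
      | tmul d e =>
        simp only [hT]
        simp [SuperAlgebra.superBimul, SuperAlgebra.rearr, SuperAlgebra.τ,
          TensorProduct.tmul_add, TensorProduct.add_tmul, TensorProduct.tmul_sub,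
          TensorProduct.sub_tmul, hT, hder, fp0, fp1, ep0, ep1]
        ring
  have hL : ∀ (f : A →ₗ[K] K) (U : A ⊗[K] A), T B.ε f U =
      f (TensorProduct.lid K A (TensorProduct.map B.ε LinearMap.id U)) := by
    intro f U
    induction U using TensorProduct.induction_on with
    | zero => simp
    | add U₁ U₂ h₁ h₂ => simp only [map_add, h₁, h₂]
    | tmul a c => simp [hT]
  have hR : ∀ (f : A →ₗ[K] K) (U : A ⊗[K] A), T f B.ε U =
      f (TensorProduct.rid K A (TensorProduct.map LinearMap.id B.ε U)) := by
    intro f U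
    induction U using TensorProduct.induction_on with
    | zero => simp
    | add U₁ U₂ h₁ h₂ => simp only [map_add, h₁, h₂]
    | tmul a c => simp [hT, mul_comm]
  have h := main (B.Δ x) (B.Δ x)
  rw [← B.Δ_mul, hxx, map_zero, map_zero, hL B.ε, hL φ, hR φ, B.counit_left, B.counit_right,
    hx0, fx] at h
  norm_num at h
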